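/- Suppose Condition 1.1 and Condition 1.2 are satisfied, and fix λ₀ > 0 with Ψ(λ₀) > 0 and Φ(λ₀) > 0. Then for any l ≥ 1 there exist constants x₀ ∈ (0,1), θ ≥ 4 and λ₂ > 0 such that, with F₀ defined from λ₀, x₀ and θ, one has L̃F₀(x,y) ≤ −λ₂ F₀(x,y) 1_{x−y≤l} for all (x,y) ∈ Δᶜ. -/

import Mathlib

open MeasureTheory

/-- For a σ-finite Borel measure `m` on `ℝ` vanishing on `(-∞,0]` and `x ∈ ℝ`,
`mShift m x = ½ (m ∧ T_x m)` where `T_x m` is the image of `m` under `z ↦ z + x`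
and `∧` is the infimum in the lattice of measures. -/
noncomputable def mShift (m : Measure ℝ) (x : ℝ) : Measure ℝ :=
  (2⁻¹ : ENNReal) • (m ⊓ Measure.map (fun z => z + x) m)

/-- First partial derivative of `F` in the first variable. -/
noncomputable def Fx (F : ℝ → ℝ → ℝ) (x y : ℝ) : ℝ := deriv (fun t => F t y) x

/-- First partial derivative of `F` in the second variable. -/
noncomputable def Fy (F : ℝ → ℝ → ℝ) (x y : ℝ) : ℝ := deriv (fun t => F x t) y

/-- Second partial derivative `F″_{xx}`. -/
noncomputable def Fxx (F : ℝ → ℝ → ℝ) (x y : ℝ) : ℝ := deriv (fun t => Fx F t y) x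

/-- Second partial derivative `F″_{yy}`. -/
noncomputable def Fyy (F : ℝ → ℝ → ℝ) (x y : ℝ) : ℝ := deriv (fun t => Fy F x t) y

/-- Mixed second partial derivative `F″_{xy}`. -/
noncomputable def Fxy (F : ℝ → ℝ → ℝ) (x y : ℝ) : ℝ := deriv (fun t => Fx F x t) y

/-- `cutoff z = z 1_{z ≤ 1}`. -/
noncomputable def cutoff (z : ℝ) : ℝ := if z ≤ 1 then z else 0

/-- The part `L̃₀` of the coupling generator. -/
noncomputable def Ltil0 (b c β : ℝ) (g : ℝ → ℝ) (μ ν : Measure ℝ)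
    (F : ℝ → ℝ → ℝ) (x y : ℝ) : ℝ :=
  (β - b * x - g x) * Fx F x y + (β - b * y - g y) * Fy F x y
    + c * x * Fxx F x y + c * y * Fyy F x y - 2 * c * y * Fxy F x y
    + (∫ z in Set.Ioi (0 : ℝ), (F (x + z) (y + z) - F x y) ∂ν)
    + (x - y) * (∫ z in Set.Ioi (0 : ℝ), (F (x + z) y - F x y - Fx F x y * cutoff z) ∂μ)
    + y * (∫ z in Set.Ioi (0 : ℝ),
        (F (x + z) (y + z) - F x y - (Fx F x y + Fy F x y) * cutoff z) ∂μ)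

/-- The part `L̃₁` of the coupling generator (induced by the lassoing process). -/
noncomputable def Ltil1 (μ ν : Measure ℝ) (F : ℝ → ℝ → ℝ) (x y : ℝ) : ℝ :=
  y * (∫ z in Set.Ioi (0 : ℝ), (F (x + z) (2 * y + z - x) - F (x + z) (y + z)) ∂(mShift μ (x - y)))
    + y * (∫ z in Set.Ioi (0 : ℝ), (F (x + z) (x + z) - F (x + z) (y + z)) ∂(mShift μ (y - x)))
    + (∫ z in Set.Ioi (0 : ℝ), (F (x + z) (2 * y + z - x) - F (x + z) (y + z)) ∂(mShift ν (x - y)))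
    + (∫ z in Set.Ioi (0 : ℝ), (F (x + z) (x + z) - F (x + z) (y + z)) ∂(mShift ν (y - x)))

/-- The coupling generator `L̃ = L̃₀ + L̃₁`. -/
noncomputable def Ltil (b c β : ℝ) (g : ℝ → ℝ) (μ ν : Measure ℝ)
    (F : ℝ → ℝ → ℝ) (x y : ℝ) : ℝ :=
  Ltil0 b c β g μ ν F x y + Ltil1 μ ν F x y

/-- `Δᶜ = D ∖ Δ = {(x,y) : 0 ≤ y < x}`. -/
def DeltaC : Set (ℝ × ℝ) := {p | 0 ≤ p.2 ∧ p.2 < p.1}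

/-- `F` belongs to the domain of the coupling generator `L̃`: all the integrals
appearing in `L̃₀F` and `L̃₁F` converge at each point of `Δᶜ`, and `L̃F` is
bounded on compact subsets of `Δᶜ`. -/
def InDomLtil (b c β : ℝ) (g : ℝ → ℝ) (μ ν : Measure ℝ) (F : ℝ → ℝ → ℝ) : Prop :=
  (∀ x y : ℝ, 0 ≤ y → y < x →
    MeasureTheory.IntegrableOn (fun z => F (x + z) (y + z) - F x y) (Set.Ioi 0) ν ∧
    MeasureTheory.IntegrableOn (fun z => F (x + z) y - F x y - Fx F x y * cutoff z)
      (Set.Ioi 0) μ ∧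
    MeasureTheory.IntegrableOn
      (fun z => F (x + z) (y + z) - F x y - (Fx F x y + Fy F x y) * cutoff z) (Set.Ioi 0) μ ∧
    MeasureTheory.IntegrableOn (fun z => F (x + z) (2 * y + z - x) - F (x + z) (y + z))
      (Set.Ioi 0) (mShift μ (x - y)) ∧
    MeasureTheory.IntegrableOn (fun z => F (x + z) (x + z) - F (x + z) (y + z))
      (Set.Ioi 0) (mShift μ (y - x)) ∧
    MeasureTheory.IntegrableOn (fun z => F (x + z) (2 * y + z - x) - F (x + z) (y + z))
      (Set.Ioi 0) (mShift ν (x - y)) ∧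
    MeasureTheory.IntegrableOn (fun z => F (x + z) (x + z) - F (x + z) (y + z))
      (Set.Ioi 0) (mShift ν (y - x))) ∧
  (∀ K : Set (ℝ × ℝ), K ⊆ DeltaC → IsCompact K →
    ∃ M : ℝ, ∀ p ∈ K, |Ltil b c β g μ ν F p.1 p.2| ≤ M)

/-- The branching mechanism `Ψ(λ) = bλ + cλ² + ∫₀^∞(e^{−λz} − 1 + λz 1_{z≤1}) μ(dz)`. -/
noncomputable def Psi (b c : ℝ) (μ : Measure ℝ) (l : ℝ) : ℝ :=
  b * l + c * l ^ 2
    + ∫ z in Set.Ioi (0 : ℝ), (Real.exp (-(l * z)) - 1 + l * cutoff z) ∂μ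

/-- The immigration mechanism `Φ(λ) = βλ + ∫₀^∞(1 − e^{−λz}) ν(dz)`. -/
noncomputable def Phi (β : ℝ) (ν : Measure ℝ) (l : ℝ) : ℝ :=
  β * l + ∫ z in Set.Ioi (0 : ℝ), (1 - Real.exp (-(l * z))) ∂ν

/-- `ψ(x) = 1 − e^{−λ₀ x}`. -/
noncomputable def psi0 (lam0 x : ℝ) : ℝ := 1 - Real.exp (-(lam0 * x))

/-- `φ(x) = θ + (1 − x/x₀)³` for `0 ≤ x < x₀`, and `φ(x) = θ` for `x ≥ x₀`. -/
noncomputable def phi0 (x0 θ x : ℝ) : ℝ := if x < x0 then θ + (1 - x / x0) ^ 3 else θ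

/-- `F₀(x,y) = φ(x)[1 + ψ(x−y)] 1_{x≠y}`. -/
noncomputable def F0 (lam0 x0 θ : ℝ) (x y : ℝ) : ℝ :=
  if x = y then 0 else phi0 x0 θ x * (1 + psi0 lam0 (x - y))

/-- The truncated linear function `x ↦ (1 - 2x)⁺`, whose cube is the non-constant part of
`phi0 (1/2) θ`. -/
noncomputable def ramp (x : ℝ) : ℝ := max 0 (1 - 2 * x)

lemma ramp_nonneg (x : ℝ) : 0 ≤ ramp x := le_max_left _ _

lemma ramp_le_one {x : ℝ} (hx : 0 ≤ x) : ramp x ≤ 1 := max_le zero_le_one (by linarith)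

lemma ramp_add {x z : ℝ} (hz : 0 ≤ z) : ramp (x + z) = max 0 (ramp x - 2 * z) := by
  unfold ramp
  rcases le_total 0 (1 - 2 * x) with h | h
  · rw [max_eq_right h]; congr 1; ring
  · rw [max_eq_left h, max_eq_left (by linarith), max_eq_left (by linarith)]

lemma continuous_ramp : Continuous ramp := by unfold ramp; fun_prop

lemma hasDerivAt_max_zero_pow (n : ℕ) (t : ℝ) :
    HasDerivAt (fun s : ℝ => max 0 s ^ (n + 2)) ((n + 2 : ℕ) * max 0 t ^ (n + 1)) t := by
  rcases lt_trichotomy t 0 with h | rfl | h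
  · have : (fun s : ℝ => max 0 s ^ (n + 2)) =ᶠ[nhds t] fun _ => 0 := by
      filter_upwards [gt_mem_nhds h] with s hs
      simp [max_eq_left hs.le]
    simpa [max_eq_left h.le] using (hasDerivAt_const t (0 : ℝ)).congr_of_eventuallyEq this
  · have h : (fun s : ℝ => max 0 s ^ (n + 2)) =O[nhds 0] fun s => ‖s - 0‖ ^ (n + 2) := by
      refine Asymptotics.IsBigO.of_bound 1 (Filter.Eventually.of_forall fun s => ?_)
      rw [norm_pow, norm_pow, one_mul, sub_zero, norm_norm]
      gcongr
      rw [Real.norm_eq_abs, Real.norm_eq_abs, abs_of_nonneg (le_max_left _ _)]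
      exact max_le (abs_nonneg _) (le_abs_self _)
    simpa using (h.hasFDerivAt (by omega)).hasDerivAt
  · have : (fun s : ℝ => max 0 s ^ (n + 2)) =ᶠ[nhds t] fun s => s ^ (n + 2) := by
      filter_upwards [lt_mem_nhds h] with s hs
      simp [max_eq_right hs.le]
    simpa [max_eq_right h.le] using (hasDerivAt_pow (n + 2) t).congr_of_eventuallyEq this

lemma hasDerivAt_ramp_pow (n : ℕ) (x : ℝ) :
    HasDerivAt (fun t => ramp t ^ (n + 2)) (-2 * (n + 2 : ℕ) * ramp x ^ (n + 1)) x := by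
  have h : HasDerivAt (fun t : ℝ => 1 - 2 * t) (-2) x := by
    simpa using ((hasDerivAt_id x).const_mul 2).const_sub 1
  have := (hasDerivAt_max_zero_pow n (1 - 2 * x)).comp x h
  exact this.congr_deriv (by unfold ramp; ring)

lemma phi0_half (θ x : ℝ) : phi0 (1 / 2) θ x = θ + ramp x ^ 3 := by
  unfold phi0 ramp
  split_ifs with h
  · rw [max_eq_right (by linarith)]; ring
  · rw [max_eq_left (by linarith)]; ring

lemma F0_half {lam θ x y : ℝ} (h : x ≠ y) :
    F0 lam (1 / 2) θ x y = (θ + ramp x ^ 3) * (2 - Real.exp (-(lam * (x - y)))) := by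
  rw [F0, if_neg h, phi0_half, psi0]; ring

section Derivatives

variable {lam θ x y : ℝ}

lemma hasDerivAt_exp_left : HasDerivAt (fun t => Real.exp (-(lam * (t - y))))
    (-(lam * Real.exp (-(lam * (x - y))))) x := by
  have h : HasDerivAt (fun t : ℝ => -(lam * (t - y))) (-lam) x := by
    exact ((((hasDerivAt_id x).sub_const y).const_mul lam).neg).congr_deriv (by ring)
  exact h.exp.congr_deriv (by ring)

lemma hasDerivAt_exp_right : HasDerivAt (fun t => Real.exp (-(lam * (x - t))))
    (lam * Real.exp (-(lam * (x - y)))) y := by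
  have h : HasDerivAt (fun t : ℝ => -(lam * (x - t))) lam y := by
    exact ((((hasDerivAt_id y).const_sub x).const_mul lam).neg).congr_deriv (by ring)
  exact h.exp.congr_deriv (by ring)

lemma Fx_F0 (h : y < x) : Fx (F0 lam (1 / 2) θ) x y =
    -(6 * ramp x ^ 2) * (2 - Real.exp (-(lam * (x - y))))
      + (θ + ramp x ^ 3) * (lam * Real.exp (-(lam * (x - y)))) := by
  refine HasDerivAt.deriv ?_
  have e : (fun t => F0 lam (1 / 2) θ t y) =ᶠ[nhds x]
      fun t => (θ + ramp t ^ 3) * (2 - Real.exp (-(lam * (t - y)))) := by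
    filter_upwards [lt_mem_nhds h] with t ht using F0_half ht.ne'
  refine HasDerivAt.congr_of_eventuallyEq ?_ e
  refine HasDerivAt.congr_deriv (((hasDerivAt_ramp_pow 1 x).const_add θ).mul
    ((hasDerivAt_exp_left (lam := lam) (y := y)).const_sub 2)) ?_
  push_cast; ring

lemma Fy_F0 (h : y < x) : Fy (F0 lam (1 / 2) θ) x y =
    -((θ + ramp x ^ 3) * (lam * Real.exp (-(lam * (x - y))))) := by
  refine HasDerivAt.deriv ?_
  have e : (fun t => F0 lam (1 / 2) θ x t) =ᶠ[nhds y]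
      fun t => (θ + ramp x ^ 3) * (2 - Real.exp (-(lam * (x - t)))) := by
    filter_upwards [gt_mem_nhds h] with t ht using F0_half ht.ne'
  refine HasDerivAt.congr_of_eventuallyEq ?_ e
  refine HasDerivAt.congr_deriv (((hasDerivAt_exp_right (lam := lam) (x := x) (y := y)).const_sub 2).const_mul
    (θ + ramp x ^ 3)) ?_
  ring

lemma Fxx_F0 (h : y < x) : Fxx (F0 lam (1 / 2) θ) x y =
    24 * ramp x * (2 - Real.exp (-(lam * (x - y))))
      - 12 * ramp x ^ 2 * (lam * Real.exp (-(lam * (x - y))))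
      - (θ + ramp x ^ 3) * (lam ^ 2 * Real.exp (-(lam * (x - y)))) := by
  refine HasDerivAt.deriv ?_
  have e : (fun t => Fx (F0 lam (1 / 2) θ) t y) =ᶠ[nhds x]
      fun t => -(6 * ramp t ^ 2) * (2 - Real.exp (-(lam * (t - y))))
      + (θ + ramp t ^ 3) * (lam * Real.exp (-(lam * (t - y)))) := by
    filter_upwards [lt_mem_nhds h] with t ht using Fx_F0 ht
  refine HasDerivAt.congr_of_eventuallyEq ?_ e
  have hE := hasDerivAt_exp_left (lam := lam) (x := x) (y := y)
  refine HasDerivAt.congr_deriv (((((hasDerivAt_ramp_pow 0 x).const_mul 6).neg).mul (hE.const_sub 2)).add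
    (((hasDerivAt_ramp_pow 1 x).const_add θ).mul (hE.const_mul lam))) ?_
  simp only [Pi.neg_apply]
  push_cast; ring

lemma Fyy_F0 (h : y < x) : Fyy (F0 lam (1 / 2) θ) x y =
    -((θ + ramp x ^ 3) * (lam ^ 2 * Real.exp (-(lam * (x - y))))) := by
  refine HasDerivAt.deriv ?_
  have e : (fun t => Fy (F0 lam (1 / 2) θ) x t) =ᶠ[nhds y]
      fun t => -((θ + ramp x ^ 3) * (lam * Real.exp (-(lam * (x - t))))) := by
    filter_upwards [gt_mem_nhds h] with t ht using Fy_F0 ht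
  refine HasDerivAt.congr_of_eventuallyEq ?_ e
  refine HasDerivAt.congr_deriv ((((hasDerivAt_exp_right (lam := lam) (x := x) (y := y)).const_mul lam).const_mul
    (θ + ramp x ^ 3)).neg) ?_
  ring

lemma Fxy_F0 (h : y < x) : Fxy (F0 lam (1 / 2) θ) x y =
    6 * ramp x ^ 2 * (lam * Real.exp (-(lam * (x - y))))
      + (θ + ramp x ^ 3) * (lam ^ 2 * Real.exp (-(lam * (x - y)))) := by
  refine HasDerivAt.deriv ?_
  have e : (fun t => Fx (F0 lam (1 / 2) θ) x t) =ᶠ[nhds y]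
      fun t => -(6 * ramp x ^ 2) * (2 - Real.exp (-(lam * (x - t))))
      + (θ + ramp x ^ 3) * (lam * Real.exp (-(lam * (x - t)))) := by
    filter_upwards [gt_mem_nhds h] with t ht using Fx_F0 ht
  refine HasDerivAt.congr_of_eventuallyEq ?_ e
  have hE := hasDerivAt_exp_right (lam := lam) (x := x) (y := y)
  refine HasDerivAt.congr_deriv (((hE.const_sub 2).const_mul (-(6 * ramp x ^ 2))).add
    ((hE.const_mul lam).const_mul (θ + ramp x ^ 3))) ?_
  ring

end Derivatives

section Increments

variable {q s z : ℝ}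

lemma cube_taylor_nonneg (hq : 0 ≤ q) (hz : 0 ≤ z) (hs : s = max 0 (q - 2 * z)) :
    0 ≤ s ^ 3 - q ^ 3 + 6 * q ^ 2 * z := by
  rcases le_total 0 (q - 2 * z) with h | h
  · rw [hs, max_eq_right h]
    nlinarith [mul_nonneg h (sq_nonneg z), mul_nonneg hq (sq_nonneg z)]
  · rw [hs, max_eq_left h]
    nlinarith [mul_nonneg (neg_nonneg.2 h) (sq_nonneg q), mul_nonneg hz (sq_nonneg q)]

lemma cube_taylor_le (hq : 0 ≤ q) (hz : 0 ≤ z) (hs : s = max 0 (q - 2 * z)) :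
    s ^ 3 - q ^ 3 + 6 * q ^ 2 * z ≤ 12 * q * z ^ 2 := by
  rcases le_total 0 (q - 2 * z) with h | h
  · rw [hs, max_eq_right h]
    nlinarith [pow_nonneg hz 3]
  · rw [hs, max_eq_left h]
    nlinarith [mul_nonneg hq (sq_nonneg (q - 3 * z)), mul_nonneg hq (sq_nonneg z)]

lemma cube_increment_nonpos (hq : 0 ≤ q) (hz : 0 ≤ z) (hs : s = max 0 (q - 2 * z)) :
    s ^ 3 - q ^ 3 ≤ 0 := by
  have h0 : 0 ≤ s := hs ▸ le_max_left _ _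
  have h1 : s ≤ q := hs ▸ max_le hq (by linarith)
  have := pow_le_pow_left₀ h0 h1 3
  linarith

lemma neg_le_cube_increment (hq : 0 ≤ q) (hq1 : q ≤ 1) (hz : 0 ≤ z)
    (hs : s = max 0 (q - 2 * z)) : -(6 * min 1 z) ≤ s ^ 3 - q ^ 3 := by
  have h0 : 0 ≤ s := hs ▸ le_max_left _ _
  have h3 : q ^ 3 ≤ 1 := pow_le_one₀ hq hq1
  have hs3 : 0 ≤ s ^ 3 := pow_nonneg h0 3
  rcases le_total 1 z with h | h
  · rw [min_eq_left h]; linarith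
  · rw [min_eq_right h]
    have := cube_taylor_nonneg hq hz hs
    nlinarith [mul_nonneg hz (sub_nonneg.2 (pow_le_one₀ hq hq1 (n := 2)))]

lemma cube_increment_le (hq : 1 / 2 ≤ q) (hz : 0 ≤ z) (hs : s = max 0 (q - 2 * z)) :
    s ^ 3 - q ^ 3 ≤ -(min 1 z / 8) := by
  have h1 := min_le_left 1 z
  have h2 := min_le_right 1 z
  rcases le_total 0 (q - 2 * z) with h | h
  · have h0 : 0 ≤ s := hs ▸ le_max_left _ _
    have h3 : s = q - 2 * z := by rw [hs, max_eq_right h]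
    have : q ^ 3 - s ^ 3 = 2 * z * (q ^ 2 + q * s + s ^ 2) := by rw [h3]; ring
    have h5 : 1 / 4 ≤ q ^ 2 + q * s + s ^ 2 := by
      nlinarith [mul_nonneg (by linarith : (0:ℝ) ≤ q) h0, sq_nonneg s]
    nlinarith [mul_le_mul_of_nonneg_left h5 hz]
  · rw [hs, max_eq_left h]
    have : (1 / 2 : ℝ) ^ 3 ≤ q ^ 3 := pow_le_pow_left₀ (by norm_num) hq 3
    norm_num at this ⊢
    linarith

end Increments

section Integrals

variable {lam θ x y : ℝ} {μ ν : Measure ℝ}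

lemma measurable_cutoff : Measurable cutoff :=
  Measurable.ite measurableSet_Iic measurable_id measurable_const

lemma integrable_of_lintegral_ofReal_lt_top {h : ℝ → ℝ} (hm : Measurable h)
    (hpos : ∀ᵐ z ∂μ, 0 ≤ h z) (hfin : ∫⁻ z, ENNReal.ofReal (h z) ∂μ < ⊤) : Integrable h μ :=
  ⟨hm.aestronglyMeasurable, (hasFiniteIntegral_iff_ofReal hpos).2 hfin⟩

/-- No integrability of `f` is needed, since the Bochner integral of a non-integrable function
is `0`. -/
lemma integral_le_of_le_of_nonneg {m : Measure ℝ} {f h : ℝ → ℝ} (hfh : f ≤ᵐ[m] h)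
    (h0 : 0 ≤ᵐ[m] h) (hh : Integrable h m) : ∫ z, f z ∂m ≤ ∫ z, h z ∂m := by
  by_cases hf : Integrable f m
  · exact integral_mono_ae hf hh hfh
  · rw [integral_undef hf]
    exact integral_nonneg_of_ae h0

lemma one_sub_exp_neg_le (t : ℝ) : 1 - Real.exp (-t) ≤ t := by
  have := Real.add_one_le_exp (-t)
  linarith

lemma exp_neg_sub_one_add_le {t : ℝ} (ht : 0 ≤ t) : Real.exp (-t) - 1 + t ≤ t ^ 2 := by
  have h1 := Real.add_one_le_exp t
  have h2 : Real.exp (-t) ≤ 1 / (1 + t) := by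
    rw [Real.exp_neg, ← one_div]
    exact one_div_le_one_div_of_le (by linarith) (by linarith)
  have h3 : 1 / (1 + t) - 1 + t ≤ t ^ 2 := by
    rw [← sub_nonneg]
    have : t ^ 2 - (1 / (1 + t) - 1 + t) = t ^ 3 / (1 + t) := by field_simp; ring
    rw [this]; positivity
  linarith

lemma integrableOn_branching (hlam : 0 < lam)
    (hμ : IntegrableOn (fun z => min 1 (z ^ 2)) (Set.Ioi 0) μ) :
    IntegrableOn (fun z => Real.exp (-(lam * z)) - 1 + lam * cutoff z) (Set.Ioi 0) μ := by
  refine Integrable.mono' (hμ.const_mul (1 + lam ^ 2)) ?_ ?_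
  · have := measurable_cutoff
    fun_prop
  · filter_upwards [ae_restrict_mem measurableSet_Ioi] with z (hz : 0 < z)
    have hlz : 0 ≤ lam * z := by positivity
    have hE : Real.exp (-(lam * z)) ≤ 1 := Real.exp_le_one_iff.2 (by linarith)
    have hE0 := Real.exp_pos (-(lam * z))
    rw [Real.norm_eq_abs, abs_le, cutoff]
    split_ifs with h
    · rw [min_eq_right (pow_le_one₀ hz.le h)]
      have h1 := one_sub_exp_neg_le (lam * z)
      have h2 := exp_neg_sub_one_add_le hlz
      constructor <;> nlinarith [sq_nonneg z, sq_nonneg (lam * z)]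
    · rw [min_eq_left (one_le_pow₀ (not_le.1 h).le)]
      constructor <;> nlinarith [sq_nonneg lam]

lemma integrableOn_ramp_increment (hx : 0 ≤ x)
    (hν : IntegrableOn (fun z => min 1 z) (Set.Ioi 0) ν) :
    IntegrableOn (fun z => ramp (x + z) ^ 3 - ramp x ^ 3) (Set.Ioi 0) ν := by
  refine Integrable.mono' (hν.const_mul 6) ?_ ?_
  · have := continuous_ramp
    exact (by fun_prop : Continuous fun z => ramp (x + z) ^ 3 - ramp x ^ 3).aestronglyMeasurable
  · filter_upwards [ae_restrict_mem measurableSet_Ioi] with z (hz : 0 < z)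
    rw [Real.norm_eq_abs, abs_le]
    have h0 : 0 ≤ min 1 z := le_min zero_le_one hz.le
    exact ⟨neg_le_cube_increment (ramp_nonneg x) (ramp_le_one hx) hz.le (ramp_add hz.le),
      (cube_increment_nonpos (ramp_nonneg x) hz.le (ramp_add hz.le)).trans (by linarith)⟩

lemma setIntegral_ramp_increment_nonpos (m : Measure ℝ) :
    ∫ z in Set.Ioi 0, (ramp (x + z) ^ 3 - ramp x ^ 3) ∂m ≤ 0 :=
  setIntegral_nonpos measurableSet_Ioi fun _ hz =>
    cube_increment_nonpos (ramp_nonneg x) (le_of_lt hz) (ramp_add (le_of_lt hz))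

lemma setIntegral_ramp_increment_le (hx : 0 ≤ x) (hx4 : x ≤ 1 / 4)
    (hν : IntegrableOn (fun z => min 1 z) (Set.Ioi 0) ν) :
    ∫ z in Set.Ioi 0, (ramp (x + z) ^ 3 - ramp x ^ 3) ∂ν
      ≤ -((∫ z in Set.Ioi 0, min 1 z ∂ν) / 8) := by
  rw [← integral_div, ← integral_neg]
  refine setIntegral_mono_on (integrableOn_ramp_increment hx hν) (hν.div_const 8).neg
    measurableSet_Ioi fun z hz => ?_
  refine cube_increment_le ?_ (le_of_lt hz) (ramp_add (le_of_lt hz))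
  exact le_max_of_le_right (by linarith)

/-- The Taylor remainder of `ramp ^ 3`, with the linear term cut off at `1`. -/
lemma ramp_remainder_le {z : ℝ} (hz : 0 < z) :
    ramp (x + z) ^ 3 - ramp x ^ 3 + 6 * ramp x ^ 2 * cutoff z
      ≤ 12 * ramp x * min 1 (z ^ 2) := by
  have hq := ramp_nonneg x
  rw [cutoff]
  split_ifs with h
  · rw [min_eq_right (pow_le_one₀ hz.le h)]
    exact cube_taylor_le hq hz.le (ramp_add hz.le)
  · have := cube_increment_nonpos hq hz.le (ramp_add hz.le)
    have h1 : 0 ≤ min 1 (z ^ 2) := by positivity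
    nlinarith [mul_nonneg hq h1]

lemma exp_neg_mul_mem {d : ℝ} (hlam : 0 < lam) (hd : 0 ≤ d) :
    0 < Real.exp (-(lam * d)) ∧ Real.exp (-(lam * d)) ≤ 1 :=
  ⟨Real.exp_pos _, Real.exp_le_one_iff.2 (by nlinarith)⟩

lemma setIntegral_immigration_jump (h : y < x) :
    ∫ z in Set.Ioi (0 : ℝ), (F0 lam (1 / 2) θ (x + z) (y + z) - F0 lam (1 / 2) θ x y) ∂ν
      = (2 - Real.exp (-(lam * (x - y))))
        * ∫ z in Set.Ioi (0 : ℝ), (ramp (x + z) ^ 3 - ramp x ^ 3) ∂ν := by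
  rw [← integral_const_mul]
  refine integral_congr_ae (Filter.Eventually.of_forall fun z => ?_)
  simp only [F0_half h.ne', F0_half (show x + z ≠ y + z by simpa using h.ne'),
    add_sub_add_right_eq_sub]
  ring

lemma setIntegral_common_jump_le (hlam : 0 < lam) (h : y < x)
    (hμ : IntegrableOn (fun z => min 1 (z ^ 2)) (Set.Ioi 0) μ) :
    ∫ z in Set.Ioi (0 : ℝ), (F0 lam (1 / 2) θ (x + z) (y + z) - F0 lam (1 / 2) θ x y
        - (Fx (F0 lam (1 / 2) θ) x y + Fy (F0 lam (1 / 2) θ) x y) * cutoff z) ∂μ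
      ≤ (2 - Real.exp (-(lam * (x - y)))) * (12 * ramp x)
        * ∫ z in Set.Ioi (0 : ℝ), min 1 (z ^ 2) ∂μ := by
  obtain ⟨he0, he1⟩ := exp_neg_mul_mem hlam (sub_nonneg.2 h.le)
  have hq := ramp_nonneg x
  have hB : 0 ≤ 2 - Real.exp (-(lam * (x - y))) := by linarith
  rw [← integral_const_mul]
  refine integral_le_of_le_of_nonneg ?_ ?_ (hμ.const_mul _)
  · filter_upwards [ae_restrict_mem measurableSet_Ioi] with z (hz : 0 < z)
    rw [F0_half h.ne', F0_half (show x + z ≠ y + z by simpa using h.ne'),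
      add_sub_add_right_eq_sub, Fx_F0 h, Fy_F0 h]
    have := mul_le_mul_of_nonneg_left (ramp_remainder_le (x := x) hz) hB
    linarith
  · exact Filter.Eventually.of_forall fun z => by
      have : 0 ≤ min 1 (z ^ 2) := by positivity
      positivity

lemma setIntegral_separate_jump_le (hlam : 0 < lam) (hx : 0 ≤ x) (h : y < x)
    (hμ : IntegrableOn (fun z => min 1 (z ^ 2)) (Set.Ioi 0) μ) :
    ∫ z in Set.Ioi (0 : ℝ), (F0 lam (1 / 2) θ (x + z) y - F0 lam (1 / 2) θ x y
        - Fx (F0 lam (1 / 2) θ) x y * cutoff z) ∂μ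
      ≤ (2 - Real.exp (-(lam * (x - y)))) * (12 * ramp x)
          * (∫ z in Set.Ioi (0 : ℝ), min 1 (z ^ 2) ∂μ)
        - (θ + ramp x ^ 3) * Real.exp (-(lam * (x - y)))
          * ∫ z in Set.Ioi (0 : ℝ), (Real.exp (-(lam * z)) - 1 + lam * cutoff z) ∂μ := by
  obtain ⟨he0, he1⟩ := exp_neg_mul_mem hlam (sub_nonneg.2 h.le)
  have hq := ramp_nonneg x
  have hq1 := ramp_le_one hx
  set e := Real.exp (-(lam * (x - y))) with he
  set q := ramp x with hq_def
  have hB : 0 ≤ 2 - e := by linarith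
  let a : ℝ → ℝ := fun z => (ramp (x + z) ^ 3 - q ^ 3) * (2 - e * Real.exp (-(lam * z)))
    + 6 * q ^ 2 * (2 - e) * cutoff z
  have ha (z : ℝ) : a z = (2 - e) * (ramp (x + z) ^ 3 - q ^ 3 + 6 * q ^ 2 * cutoff z)
      + (ramp (x + z) ^ 3 - q ^ 3) * (e * (1 - Real.exp (-(lam * z)))) := by
    simp only [a]; ring
  have hsplit : Set.EqOn (fun z => F0 lam (1 / 2) θ (x + z) y - F0 lam (1 / 2) θ x y
        - Fx (F0 lam (1 / 2) θ) x y * cutoff z)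
      (fun z => a z - (θ + q ^ 3) * e * (Real.exp (-(lam * z)) - 1 + lam * cutoff z))
      (Set.Ioi 0) := by
    intro z (hz : 0 < z)
    have hE : Real.exp (-(lam * (x + z - y))) = e * Real.exp (-(lam * z)) := by
      rw [he, ← Real.exp_add]; congr 1; ring
    simp only [F0_half h.ne', F0_half (show x + z ≠ y by linarith), Fx_F0 h, hE, a, ← he,
      ← hq_def]
    ring
  have ha_le : ∀ z ∈ Set.Ioi (0 : ℝ), a z ≤ (2 - e) * (12 * q) * min 1 (z ^ 2) := by
    intro z (hz : 0 < z)
    rw [ha]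
    have h1 := mul_le_mul_of_nonneg_left (ramp_remainder_le (x := x) hz) hB
    have h2 := mul_nonpos_of_nonpos_of_nonneg
      (cube_increment_nonpos hq hz.le (ramp_add (x := x) hz.le))
      (mul_nonneg he0.le (sub_nonneg.2 (exp_neg_mul_mem hlam hz.le).2))
    linarith
  have hle_a : ∀ z ∈ Set.Ioi (0 : ℝ), -((6 * lam + 12) * min 1 (z ^ 2)) ≤ a z := by
    intro z (hz : 0 < z)
    obtain ⟨hE0, hE1⟩ := exp_neg_mul_mem hlam hz.le
    have h1 := neg_le_cube_increment hq hq1 hz.le (ramp_add (x := x) hz.le)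
    by_cases hz1 : z ≤ 1
    · rw [ha, cutoff, if_pos hz1, min_eq_right (pow_le_one₀ hz.le hz1)]
      rw [min_eq_right hz1] at h1
      have h2 := mul_nonneg hB (cube_taylor_nonneg hq hz.le (ramp_add (x := x) hz.le))
      have h3 : 0 ≤ e * (1 - Real.exp (-(lam * z))) := by nlinarith
      have h4 : e * (1 - Real.exp (-(lam * z))) ≤ lam * z := by
        nlinarith [one_sub_exp_neg_le (lam * z)]
      nlinarith [mul_le_mul_of_nonneg_right h1 h3, mul_le_mul_of_nonneg_left h4 hz.le]
    · have hz1' := (not_le.1 hz1).le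
      simp only [a]
      rw [cutoff, if_neg hz1, min_eq_left (one_le_pow₀ hz1')]
      rw [min_eq_left hz1'] at h1
      have h3 : 0 ≤ 2 - e * Real.exp (-(lam * z)) := by nlinarith
      have h4 : 2 - e * Real.exp (-(lam * z)) ≤ 2 := by nlinarith
      nlinarith [mul_le_mul_of_nonneg_right h1 h3]
  have ha_int : IntegrableOn a (Set.Ioi 0) μ := by
    refine Integrable.mono' (hμ.const_mul (6 * lam + 36)) ?_ ?_
    · have := measurable_cutoff
      have := continuous_ramp.measurable
      fun_prop
    · filter_upwards [ae_restrict_mem measurableSet_Ioi] with z hz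
      have hm : 0 ≤ min 1 (z ^ 2) := by positivity
      have h1 := hle_a z hz
      have h2 := ha_le z hz
      have h3 : (2 - e) * (12 * q) ≤ 24 := by nlinarith
      rw [Real.norm_eq_abs, abs_le]
      constructor <;> nlinarith [mul_le_mul_of_nonneg_right h3 hm, mul_nonneg hlam.le hm]
  rw [setIntegral_congr_fun measurableSet_Ioi hsplit,
    integral_sub ha_int ((integrableOn_branching hlam hμ).const_mul _), integral_const_mul]
  gcongr
  rw [← integral_const_mul]
  exact setIntegral_mono_on ha_int (hμ.const_mul _) measurableSet_Ioi ha_le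

end Integrals

lemma Ltil0_F0_le {b c β lam θ x y : ℝ} {g : ℝ → ℝ} {μ ν : Measure ℝ} (hc : 0 ≤ c)
    (hlam : 0 < lam) (hθ : 0 ≤ θ) (hy : 0 ≤ y) (h : y < x)
    (hgmono : MonotoneOn g (Set.Ici 0))
    (hμ : IntegrableOn (fun z => min 1 (z ^ 2)) (Set.Ioi 0) μ) :
    Ltil0 b c β g μ ν (F0 lam (1 / 2) θ) x y
      ≤ (2 - Real.exp (-(lam * (x - y))))
          * ((∫ z in Set.Ioi (0 : ℝ), (ramp (x + z) ^ 3 - ramp x ^ 3) ∂ν)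
            - 6 * β * ramp x ^ 2 + 6 * ramp x ^ 2 * (b * x + g x) + 24 * c * x * ramp x
            + 12 * x * ramp x * ∫ z in Set.Ioi (0 : ℝ), min 1 (z ^ 2) ∂μ)
        - (θ + ramp x ^ 3) * (Real.exp (-(lam * (x - y)))
            * ((x - y) * Psi b c μ lam + 4 * c * y * lam ^ 2)) := by
  have hx : 0 ≤ x := hy.trans h.le
  have h1 := mul_le_mul_of_nonneg_left
    (setIntegral_separate_jump_le (θ := θ) hlam hx h hμ) (sub_nonneg.2 h.le)
  have h2 := mul_le_mul_of_nonneg_left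
    (setIntegral_common_jump_le (θ := θ) hlam h hμ) hy
  have he := (exp_neg_mul_mem hlam (sub_nonneg.2 h.le)).1
  have hq := ramp_nonneg x
  have hφ : 0 ≤ θ + ramp x ^ 3 := by positivity
  have hg : 0 ≤ (θ + ramp x ^ 3) * lam * Real.exp (-(lam * (x - y))) * (g x - g y) :=
    mul_nonneg (by positivity) (sub_nonneg.2 (hgmono hy hx h.le))
  have hcross : 0 ≤ 12 * c * ramp x ^ 2 * lam * Real.exp (-(lam * (x - y))) * (x + y) := by
    positivity
  rw [Ltil0, setIntegral_immigration_jump h, Fxx_F0 h, Fyy_F0 h, Fxy_F0 h, Psi]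
  rw [Fx_F0 h, Fy_F0 h] at *
  linarith

section Lasso

variable {m : Measure ℝ} {u : ℝ}

lemma map_inf_map_add (m : Measure ℝ) (u : ℝ) :
    Measure.map (fun z => z + -u) (m ⊓ Measure.map (fun z => z + u) m)
      = m ⊓ Measure.map (fun z => z + -u) m := by
  have hcancel (v : ℝ) (n : Measure ℝ) :
      Measure.map (fun z => z + -v) (Measure.map (fun z => z + v) n) = n := by
    rw [Measure.map_map (by fun_prop) (by fun_prop)]
    convert Measure.map_id using 2
    ext z; simp
  have hle (v : ℝ) : Measure.map (fun z => z + -v) (m ⊓ Measure.map (fun z => z + v) m)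
      ≤ m ⊓ Measure.map (fun z => z + -v) m := by
    refine le_inf ?_ (Measure.map_mono inf_le_left (by fun_prop))
    exact (Measure.map_mono inf_le_right (by fun_prop)).trans_eq (hcancel v m)
  refine le_antisymm (hle u) ?_
  have h := hle (-u)
  rw [neg_neg] at h
  have h' := Measure.map_mono h (f := fun z => z + -u) (by fun_prop)
  rwa [hcancel] at h'

lemma inf_map_add_Ioc (hm : m (Set.Iic 0) = 0) :
    (m ⊓ Measure.map (fun z => z + u) m) (Set.Ioc 0 u) = 0 := by
  refine le_antisymm ((Measure.le_iff'.1 inf_le_right _).trans ?_) bot_le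
  rw [Measure.map_apply (by fun_prop) measurableSet_Ioc]
  refine (measure_mono fun z hz => ?_).trans_eq hm
  simp only [Set.mem_preimage, Set.mem_Ioc, Set.mem_Iic] at *
  linarith

lemma inf_map_add_Ioi (hm : m (Set.Iic 0) = 0) (hu : 0 < u) :
    (m ⊓ Measure.map (fun z => z + u) m) (Set.Ioi 0)
      = (m ⊓ Measure.map (fun z => z + u) m) (Set.Ioi u) := by
  refine le_antisymm ?_ (measure_mono (Set.Ioi_subset_Ioi hu.le))
  rw [← Set.Ioc_union_Ioi_eq_Ioi hu.le]
  exact (measure_union_le _ _).trans_eq (by rw [inf_map_add_Ioc hm, zero_add])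

lemma inf_map_add_neg_Ioi (hm : m (Set.Iic 0) = 0) (hu : 0 < u) :
    (m ⊓ Measure.map (fun z => z + -u) m) (Set.Ioi 0)
      = (m ⊓ Measure.map (fun z => z + u) m) (Set.Ioi 0) := by
  rw [← map_inf_map_add, Measure.map_apply (by fun_prop) measurableSet_Ioi,
    inf_map_add_Ioi hm hu]
  congr 1
  ext z
  simp

lemma inf_map_add_Ioi_ne_top (hm : m (Set.Iic 0) = 0) (hu : 0 < u)
    (hfin : m (Set.Ioi u) ≠ ⊤) : (m ⊓ Measure.map (fun z => z + u) m) (Set.Ioi 0) ≠ ⊤ := by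
  rw [inf_map_add_Ioi hm hu]
  exact ne_top_of_le_ne_top hfin (Measure.le_iff'.1 inf_le_left _)

lemma measure_Ioi_ne_top_of_lintegral {h : ℝ → ℝ} (hmono : MonotoneOn h (Set.Ici u))
    (hpos : 0 < h u) (hfin : ∫⁻ z, ENNReal.ofReal (h z) ∂m < ⊤) : m (Set.Ioi u) ≠ ⊤ := by
  have h1 : ENNReal.ofReal (h u) * m (Set.Ioi u) ≤ ∫⁻ z, ENNReal.ofReal (h z) ∂m := by
    rw [← setLIntegral_const]
    refine (setLIntegral_mono' measurableSet_Ioi fun z hz => ?_).trans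
      (setLIntegral_le_lintegral _ _)
    exact ENNReal.ofReal_le_ofReal (hmono Set.self_mem_Ici (Set.Ioi_subset_Ici_self hz) (le_of_lt hz))
  intro htop
  rw [htop, ENNReal.mul_top (by simpa using hpos)] at h1
  exact (hfin.trans_le h1).false

lemma lasso_le {lam θ x y : ℝ} (hlam : 0 < lam) (hθ : 4 ≤ θ) (hy : 0 ≤ y) (h : y < x)
    (hm : m (Set.Iic 0) = 0) (hfin : m (Set.Ioi (x - y)) ≠ ⊤) :
    (∫ z in Set.Ioi (0 : ℝ), (F0 lam (1 / 2) θ (x + z) (2 * y + z - x)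
        - F0 lam (1 / 2) θ (x + z) (y + z)) ∂(mShift m (x - y)))
      + (∫ z in Set.Ioi (0 : ℝ), (F0 lam (1 / 2) θ (x + z) (x + z)
        - F0 lam (1 / 2) θ (x + z) (y + z)) ∂(mShift m (y - x)))
      ≤ -(θ / 4 * (m ⊓ Measure.map (fun z => z + (x - y)) m).real (Set.Ioi 0)) := by
  have hu : 0 < x - y := sub_pos.2 h
  set A := m ⊓ Measure.map (fun z => z + (x - y)) m with hA
  have hAtop : A (Set.Ioi 0) ≠ ⊤ := inf_map_add_Ioi_ne_top hm hu hfin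
  obtain ⟨he0, he1⟩ := exp_neg_mul_mem hlam hu.le
  set e := Real.exp (-(lam * (x - y))) with he
  have hne (z : ℝ) : x + z ≠ y + z := by simpa using h.ne'
  have hbound {z : ℝ} (hz : z ∈ Set.Ioi (0 : ℝ)) : 0 ≤ ramp (x + z) ^ 3 ∧ ramp (x + z) ^ 3 ≤ 1 :=
    have hz' : 0 < z := hz
    ⟨pow_nonneg (ramp_nonneg _) 3,
      pow_le_one₀ (ramp_nonneg _) (ramp_le_one (by linarith))⟩
  have half_top {n : Measure ℝ} (hn : n (Set.Ioi 0) ≠ ⊤) :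
      ((2⁻¹ : ENNReal) • n) (Set.Ioi 0) ≠ ⊤ := by
    simpa using ENNReal.mul_ne_top (by simp) hn
  have half_real (n : Measure ℝ) : ((2⁻¹ : ENNReal) • n).real (Set.Ioi 0)
      = n.real (Set.Ioi 0) / 2 := by
    simp [Measure.real, div_eq_inv_mul]
  have hconst {n : Measure ℝ} (hn : n (Set.Ioi 0) ≠ ⊤) (k : ℝ) :
      IntegrableOn (fun _ => k) (Set.Ioi 0) n :=
    integrableOn_const hn
  have h1 : (∫ z in Set.Ioi (0 : ℝ), (F0 lam (1 / 2) θ (x + z) (2 * y + z - x)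
        - F0 lam (1 / 2) θ (x + z) (y + z)) ∂(mShift m (x - y)))
      ≤ A.real (Set.Ioi 0) / 2 * ((θ + 1) * (e * (1 - e))) := by
    rw [mShift, ← hA, ← half_real, ← smul_eq_mul (_ : ℝ) ((θ + 1) * _), ← setIntegral_const]
    refine integral_le_of_le_of_nonneg ?_ ?_ (hconst (half_top hAtop) _)
    · filter_upwards [ae_restrict_mem measurableSet_Ioi] with z hz
      have hE : Real.exp (-(lam * (x + z - (2 * y + z - x)))) = e * e := by
        rw [he, ← Real.exp_add]; congr 1; ring
      rw [F0_half (hne z), F0_half (show x + z ≠ 2 * y + z - x by intro hh; linarith),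
        add_sub_add_right_eq_sub, hE, ← he]
      have := mul_le_mul_of_nonneg_right (hbound hz).2
        (mul_nonneg he0.le (sub_nonneg.2 he1))
      linarith
    · exact Filter.Eventually.of_forall fun _ =>
        mul_nonneg (by linarith) (mul_nonneg he0.le (sub_nonneg.2 he1))
  have h2 : (∫ z in Set.Ioi (0 : ℝ), (F0 lam (1 / 2) θ (x + z) (x + z)
        - F0 lam (1 / 2) θ (x + z) (y + z)) ∂(mShift m (y - x)))
      ≤ A.real (Set.Ioi 0) / 2 * (-(θ * (2 - e))) := by
    have hAB : (m ⊓ Measure.map (fun z => z + (y - x)) m) (Set.Ioi 0) = A (Set.Ioi 0) := by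
      rw [← neg_sub x y, inf_map_add_neg_Ioi hm hu]
    have hABreal : (m ⊓ Measure.map (fun z => z + (y - x)) m).real (Set.Ioi 0)
        = A.real (Set.Ioi 0) := by rw [Measure.real, hAB, Measure.real]
    have hBtop := half_top (hAB ▸ hAtop)
    have hF (z : ℝ) : F0 lam (1 / 2) θ (x + z) (x + z) - F0 lam (1 / 2) θ (x + z) (y + z)
        = -((θ + ramp (x + z) ^ 3) * (2 - e)) := by
      rw [F0_half (hne z), add_sub_add_right_eq_sub, F0, if_pos rfl, zero_sub]
    simp only [hF]
    rw [mShift, ← hABreal, ← half_real, ← smul_eq_mul, ← setIntegral_const]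
    refine setIntegral_mono_on ?_ (hconst hBtop _) measurableSet_Ioi fun z hz => ?_
    · refine Integrable.mono' (hconst hBtop ((θ + 1) * 2)) ?_ ?_
      · have := continuous_ramp
        exact (by fun_prop : Continuous fun z => -((θ + ramp (x + z) ^ 3) * (2 - e)))
          |>.aestronglyMeasurable
      · filter_upwards [ae_restrict_mem measurableSet_Ioi] with z hz
        obtain ⟨hr0, hr1⟩ := hbound hz
        rw [norm_neg, Real.norm_eq_abs, abs_of_nonneg (mul_nonneg (by linarith) (by linarith))]
        exact mul_le_mul (by linarith) (by linarith) (by linarith) (by linarith)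
    · have := mul_nonneg (hbound hz).1 (by linarith : 0 ≤ 2 - e)
      linarith
  have hk : (θ + 1) * (e * (1 - e)) - θ * (2 - e) ≤ -(θ / 2) := by
    nlinarith [sq_nonneg (e - 1 / 2)]
  have := mul_le_mul_of_nonneg_left hk (by positivity : 0 ≤ A.real (Set.Ioi 0) / 2)
  linarith

lemma Ltil1_F0_le {lam θ x y : ℝ} {μ ν : Measure ℝ} (hlam : 0 < lam) (hθ : 4 ≤ θ)
    (hy : 0 ≤ y) (h : y < x) (hμ : μ (Set.Iic 0) = 0) (hν : ν (Set.Iic 0) = 0)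
    (hμfin : μ (Set.Ioi (x - y)) ≠ ⊤) (hνfin : ν (Set.Ioi (x - y)) ≠ ⊤) :
    Ltil1 μ ν (F0 lam (1 / 2) θ) x y
      ≤ -(θ / 4 * (y * (μ ⊓ Measure.map (fun z => z + (x - y)) μ).real (Set.Ioi 0)
        + (ν ⊓ Measure.map (fun z => z + (x - y)) ν).real (Set.Ioi 0))) := by
  have h1 := mul_le_mul_of_nonneg_left (lasso_le hlam hθ hy h hμ hμfin) hy
  have h2 := lasso_le hlam hθ hy h hν hνfin
  rw [Ltil1]
  linarith

end Lasso

lemma Ltil_F0_le {b c β lam θ x y : ℝ} {g : ℝ → ℝ} {μ ν : Measure ℝ} (hc : 0 ≤ c)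
    (hlam : 0 < lam) (hθ : 4 ≤ θ) (hy : 0 ≤ y) (h : y < x)
    (hgmono : MonotoneOn g (Set.Ici 0)) (hPsi : 0 < Psi b c μ lam)
    (hμsupp : μ (Set.Iic 0) = 0) (hνsupp : ν (Set.Iic 0) = 0)
    (hμfin : μ (Set.Ioi (x - y)) ≠ ⊤) (hνfin : ν (Set.Ioi (x - y)) ≠ ⊤)
    (hμ : IntegrableOn (fun z => min 1 (z ^ 2)) (Set.Ioi 0) μ) :
    Ltil b c β g μ ν (F0 lam (1 / 2) θ) x y
      ≤ (2 - Real.exp (-(lam * (x - y))))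
          * ((∫ z in Set.Ioi (0 : ℝ), (ramp (x + z) ^ 3 - ramp x ^ 3) ∂ν)
            - 6 * β * ramp x ^ 2 + 6 * ramp x ^ 2 * (b * x + g x) + 24 * c * x * ramp x
            + 12 * x * ramp x * ∫ z in Set.Ioi (0 : ℝ), min 1 (z ^ 2) ∂μ)
        - θ * (Real.exp (-(lam * (x - y))) * ((x - y) * Psi b c μ lam + 4 * c * y * lam ^ 2)
            + (y * (μ ⊓ Measure.map (fun z => z + (x - y)) μ).real (Set.Ioi 0)
              + (ν ⊓ Measure.map (fun z => z + (x - y)) ν).real (Set.Ioi 0)) / 4) := by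
  have h0 := Ltil0_F0_le (b := b) (β := β) (ν := ν) hc hlam (by linarith : 0 ≤ θ) hy h hgmono hμ
  have h1 := Ltil1_F0_le hlam hθ hy h hμsupp hνsupp hμfin hνfin
  have hu : 0 ≤ x - y := sub_nonneg.2 h.le
  have hq := ramp_nonneg x
  have hpos : 0 ≤ ramp x ^ 3 * (Real.exp (-(lam * (x - y)))
      * ((x - y) * Psi b c μ lam + 4 * c * y * lam ^ 2)) := by positivity
  rw [Ltil]
  linarith

/-- Away from the origin and for bounded distance `x - y`, the dissipation coming from the
branching mechanism, the diffusion and the lassoing is bounded below. -/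
lemma exists_dissipation_lower_bound {b c lam l s : ℝ} {μ ν : Measure ℝ} (hc : 0 ≤ c)
    (hlam : 0 < lam) (hs : 0 < s) (hPsi : 0 < Psi b c μ lam)
    (hμsupp : μ (Set.Iic 0) = 0) (hνsupp : ν (Set.Iic 0) = 0)
    (hμfin : ∀ u > 0, μ (Set.Ioi u) ≠ ⊤) (hνfin : ∀ u > 0, ν (Set.Ioi u) ≠ ⊤)
    (hfluct : 0 < c ∨ ∃ c₀ > (0 : ℝ), ∃ κ₀ > (0 : ℝ), ∀ x : ℝ, |x| ≤ c₀ →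
      ENNReal.ofReal κ₀ ≤ (μ ⊓ Measure.map (fun z => z + x) μ) (Set.Ioi 0)
        + (ν ⊓ Measure.map (fun z => z + x) ν) (Set.Ioi 0)) :
    ∃ ε > 0, ∀ x y : ℝ, 0 ≤ y → y < x → s ≤ x → x - y ≤ l →
      ε ≤ Real.exp (-(lam * (x - y))) * ((x - y) * Psi b c μ lam + 4 * c * y * lam ^ 2)
            + (y * (μ ⊓ Measure.map (fun z => z + (x - y)) μ).real (Set.Ioi 0)
              + (ν ⊓ Measure.map (fun z => z + (x - y)) ν).real (Set.Ioi 0)) / 4 := by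
  have hel := Real.exp_pos (-(lam * l))
  have hexp {u : ℝ} (hu : u ≤ l) : Real.exp (-(lam * l)) ≤ Real.exp (-(lam * u)) :=
    Real.exp_le_exp.2 (by nlinarith)
  rcases hfluct with hc' | ⟨c₀, hc₀, κ₀, hκ₀, hκ⟩
  · refine ⟨Real.exp (-(lam * l)) * (min (Psi b c μ lam) (4 * c * lam ^ 2) * s),
      by positivity, fun x y hy h hsx hl => ?_⟩
    have hu : 0 < x - y := sub_pos.2 h
    have h1 := mul_le_mul_of_nonneg_left (min_le_left (Psi b c μ lam) (4 * c * lam ^ 2)) hu.le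
    have h2 := mul_le_mul_of_nonneg_left (min_le_right (Psi b c μ lam) (4 * c * lam ^ 2)) hy
    have hmin : 0 < min (Psi b c μ lam) (4 * c * lam ^ 2) := by positivity
    have h3 : min (Psi b c μ lam) (4 * c * lam ^ 2) * s
        ≤ (x - y) * Psi b c μ lam + 4 * c * y * lam ^ 2 := by nlinarith
    refine (mul_le_mul (hexp hl) h3 (by positivity) (Real.exp_pos _).le).trans ?_
    have : 0 ≤ (y * (μ ⊓ Measure.map (fun z => z + (x - y)) μ).real (Set.Ioi 0)
        + (ν ⊓ Measure.map (fun z => z + (x - y)) ν).real (Set.Ioi 0)) / 4 := by positivity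
    linarith
  · have hd : 0 < min c₀ (s / 2) := by positivity
    refine ⟨min (Real.exp (-(lam * l)) * (min c₀ (s / 2) * Psi b c μ lam))
      (min (s / 2) 1 * κ₀ / 4), by positivity, fun x y hy h hsx hl => ?_⟩
    have hu : 0 < x - y := sub_pos.2 h
    have hdiff : 0 ≤ 4 * c * y * lam ^ 2 := by positivity
    rcases le_total (min c₀ (s / 2)) (x - y) with hcase | hcase
    · refine (min_le_left _ _).trans ?_
      have h3 : min c₀ (s / 2) * Psi b c μ lam
          ≤ (x - y) * Psi b c μ lam + 4 * c * y * lam ^ 2 := by nlinarith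
      refine (mul_le_mul (hexp hl) h3 (by positivity) (Real.exp_pos _).le).trans ?_
      have : 0 ≤ (y * (μ ⊓ Measure.map (fun z => z + (x - y)) μ).real (Set.Ioi 0)
          + (ν ⊓ Measure.map (fun z => z + (x - y)) ν).real (Set.Ioi 0)) / 4 := by positivity
      linarith
    · refine (min_le_right _ _).trans ?_
      have hk := hκ (x - y) (by rw [abs_of_pos hu]; exact hcase.trans (min_le_left _ _))
      have hμt := inf_map_add_Ioi_ne_top hμsupp hu (hμfin _ hu)
      have hνt := inf_map_add_Ioi_ne_top hνsupp hu (hνfin _ hu)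
      have hk' : κ₀ ≤ (μ ⊓ Measure.map (fun z => z + (x - y)) μ).real (Set.Ioi 0)
          + (ν ⊓ Measure.map (fun z => z + (x - y)) ν).real (Set.Ioi 0) := by
        rw [Measure.real, Measure.real, ← ENNReal.toReal_add hμt hνt]
        exact (ENNReal.ofReal_le_iff_le_toReal (ENNReal.add_ne_top.2 ⟨hμt, hνt⟩)).1 hk
      have hys : min (s / 2) 1 ≤ y :=
        (min_le_left _ _).trans (by linarith [hcase.trans (min_le_right _ _)])
      have hmin : 0 < min (s / 2) 1 := by positivity
      have h1 := mul_le_mul_of_nonneg_left hk' hmin.le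
      have h2 := mul_le_mul_of_nonneg_right hys (measureReal_nonneg
        (μ := μ ⊓ Measure.map (fun z => z + (x - y)) μ) (s := Set.Ioi 0))
      have h3 := mul_le_mul_of_nonneg_right (min_le_right (s / 2) 1) (measureReal_nonneg
        (μ := ν ⊓ Measure.map (fun z => z + (x - y)) ν) (s := Set.Ioi 0))
      have h4 : 0 ≤ Real.exp (-(lam * (x - y)))
          * ((x - y) * Psi b c μ lam + 4 * c * y * lam ^ 2) := by positivity
      linarith

lemma immigration_pos {β lam : ℝ} {ν : Measure ℝ} (hβ : 0 ≤ β) (hlam : 0 < lam)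
    (hν : IntegrableOn (fun z => min 1 z) (Set.Ioi 0) ν) (hPhi : 0 < Phi β ν lam) :
    0 < β + ∫ z in Set.Ioi 0, min 1 z ∂ν := by
  have hI : 0 ≤ ∫ z in Set.Ioi (0 : ℝ), min 1 z ∂ν :=
    setIntegral_nonneg measurableSet_Ioi fun z hz => le_min zero_le_one (le_of_lt hz)
  have hle : ∫ z in Set.Ioi (0 : ℝ), (1 - Real.exp (-(lam * z))) ∂ν
      ≤ (1 + lam) * ∫ z in Set.Ioi (0 : ℝ), min 1 z ∂ν := by
    rw [← integral_const_mul]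
    refine integral_le_of_le_of_nonneg ?_ ?_ (hν.const_mul _)
    all_goals filter_upwards [ae_restrict_mem measurableSet_Ioi] with z (hz : 0 < z)
    · have h1 := one_sub_exp_neg_le (lam * z)
      have h2 := Real.exp_pos (-(lam * z))
      rcases le_total 1 z with h | h
      · rw [min_eq_left h]; linarith
      · rw [min_eq_right h]; linarith
    · exact mul_nonneg (by linarith) (le_min zero_le_one hz.le)
  rw [Phi] at hPhi
  by_contra hcon
  have hβ0 : β = 0 := by linarith
  have hI0 : ∫ z in Set.Ioi (0 : ℝ), min 1 z ∂ν = 0 := by linarith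
  rw [hI0] at hle
  rw [hβ0] at hPhi
  linarith

/- Proposition 4.4 of Li–Li–Wang–Zhou: under the non-triviality condition
(Condition 1.1: `Ψ(λ₀) > 0` and `Φ(λ₀) > 0` for the fixed `λ₀ > 0`) and the
fluctuation condition (Condition 1.2: `c > 0`, or
`(μ ∧ T_xμ)(0,∞) + (ν ∧ T_xν)(0,∞) ≥ κ₀` for all `|x| ≤ c₀`, with constants
`c₀, κ₀ > 0`), for every `l ≥ 1` there are constants `x₀ ∈ (0,1)`, `θ ≥ 4` and
`λ₂ > 0` such that `L̃F₀(x,y) ≤ −λ₂ F₀(x,y) 1_{x−y≤l}` for all `(x,y) ∈ Δᶜ`. -/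
theorem coupling_generator_F0_contraction
    (b c β lam0 : ℝ) (hc : 0 ≤ c) (hβ : 0 ≤ β) (hlam0 : 0 < lam0)
    (μ ν : Measure ℝ)
    (hμsupp : μ (Set.Iic 0) = 0) (hνsupp : ν (Set.Iic 0) = 0)
    (hμloc : ∫⁻ z, ENNReal.ofReal (min 1 (z ^ 2)) ∂μ < ⊤)
    (hνloc : ∫⁻ z, ENNReal.ofReal (min 1 z) ∂ν < ⊤)
    (g : ℝ → ℝ) (hg0 : g 0 = 0) (hgmono : MonotoneOn g (Set.Ici 0))
    (hgcont : ContinuousOn g (Set.Ici 0)) (hgnonneg : ∀ x ∈ Set.Ici (0 : ℝ), 0 ≤ g x)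
    (hPsi : 0 < Psi b c μ lam0) (hPhi : 0 < Phi β ν lam0)
    (hfluct : 0 < c ∨ ∃ c₀ > (0 : ℝ), ∃ κ₀ > (0 : ℝ), ∀ x : ℝ, |x| ≤ c₀ →
      ENNReal.ofReal κ₀ ≤ (μ ⊓ Measure.map (fun z => z + x) μ) (Set.Ioi 0)
        + (ν ⊓ Measure.map (fun z => z + x) ν) (Set.Ioi 0)) :
    ∀ l : ℝ, 1 ≤ l →
      ∃ x0 : ℝ, 0 < x0 ∧ x0 < 1 ∧ ∃ θ : ℝ, 4 ≤ θ ∧ ∃ lam2 : ℝ, 0 < lam2 ∧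
        ∀ x y : ℝ, 0 ≤ y → y < x →
          Ltil b c β g μ ν (F0 lam0 x0 θ) x y
            ≤ -(lam2 * F0 lam0 x0 θ x y * (if x - y ≤ l then 1 else 0)) := by
  intro l hl
  have hμ : IntegrableOn (fun z => min 1 (z ^ 2)) (Set.Ioi 0) μ :=
    (integrable_of_lintegral_ofReal_lt_top (by fun_prop)
      (Filter.Eventually.of_forall fun z => by positivity) hμloc).integrableOn
  have hνpos : ∀ᵐ z ∂ν, 0 ≤ min 1 z := by
    have : ∀ᵐ z ∂ν, z ∉ Set.Iic (0 : ℝ) := measure_eq_zero_iff_ae_notMem.1 hνsupp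
    filter_upwards [this] with z hz
    exact le_min zero_le_one (le_of_lt (not_le.1 hz))
  have hν : IntegrableOn (fun z => min 1 z) (Set.Ioi 0) ν :=
    (integrable_of_lintegral_ofReal_lt_top (by fun_prop) hνpos hνloc).integrableOn
  have hμfin : ∀ u > 0, μ (Set.Ioi u) ≠ ⊤ := fun u hu =>
    measure_Ioi_ne_top_of_lintegral (h := fun z => min 1 (z ^ 2))
      (fun v hv w _ hvw => min_le_min le_rfl
        (pow_le_pow_left₀ (hu.le.trans hv) hvw 2)) (by positivity) hμloc
  have hνfin : ∀ u > 0, ν (Set.Ioi u) ≠ ⊤ := fun u hu =>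
    measure_Ioi_ne_top_of_lintegral (h := fun z => min 1 z)
      (fun v _ w _ hvw => min_le_min le_rfl hvw) (by positivity) hνloc
  have hIμ : 0 ≤ ∫ z in Set.Ioi (0 : ℝ), min 1 (z ^ 2) ∂μ :=
    integral_nonneg fun z => by positivity
  have hκ := immigration_pos hβ hlam0 hν hPhi
  set Iμ := ∫ z in Set.Ioi (0 : ℝ), min 1 (z ^ 2) ∂μ
  set κ := β + ∫ z in Set.Ioi (0 : ℝ), min 1 z ∂ν with hκ_def
  -- near the origin the immigration dominates all other terms
  obtain ⟨s, hs0, hs4, hsmall⟩ : ∃ s > 0, s ≤ 1 / 4 ∧ ∀ x, 0 ≤ x → x < s →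
      6 * (|b| * x + g x) + 24 * c * x + 12 * x * Iμ ≤ κ / 16 := by
    have hcont : ContinuousWithinAt
        (fun x => 6 * (|b| * x + g x) + 24 * c * x + 12 * x * Iμ) (Set.Ici 0) 0 := by
      have := hgcont 0 Set.self_mem_Ici
      fun_prop
    have hev := hcont.tendsto.eventually_lt_const
      (by simpa [hg0] using hκ : _ < κ / 16)
    obtain ⟨s, hs, hball⟩ := Metric.mem_nhdsWithin_iff.1 hev
    refine ⟨min s (1 / 4), by positivity, min_le_right _ _, fun x hx hxs => ?_⟩
    refine le_of_lt (hball ⟨?_, hx⟩)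
    rw [Metric.mem_ball, Real.dist_eq, sub_zero, abs_of_nonneg hx]
    exact hxs.trans_le (min_le_left _ _)
  obtain ⟨ε, hε, hdiss⟩ := exists_dissipation_lower_bound (l := l) hc hlam0 hs0 hPsi
    hμsupp hνsupp hμfin hνfin hfluct
  have hghalf : 0 ≤ g (1 / 2) := hgnonneg _ (by norm_num [Set.mem_Ici])
  set C := 6 * (|b| + g (1 / 2)) + 24 * c + 12 * Iμ with hC
  have hC0 : 0 ≤ C := by positivity
  set θ := 4 + (2 * C + 1) / ε with hθ_def
  have hθ : 4 ≤ θ := le_add_of_nonneg_right (by positivity)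
  have hθε : 2 * C + 1 ≤ θ * ε := by
    have : (2 * C + 1) / ε * ε = 2 * C + 1 := by field_simp
    rw [hθ_def, add_mul, this]
    linarith
  refine ⟨1 / 2, by norm_num, by norm_num, θ, hθ, min 1 (κ / 16) / (2 * (θ + 1)),
    by positivity, fun x y hy h => ?_⟩
  have hx : 0 < x := hy.trans_lt h
  have hu : 0 < x - y := sub_pos.2 h
  have hmain := Ltil_F0_le (b := b) (β := β) hc hlam0 hθ hy h hgmono hPsi hμsupp hνsupp
    (hμfin _ hu) (hνfin _ hu) hμ
  obtain ⟨he0, he1⟩ := exp_neg_mul_mem hlam0 hu.le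
  have hq0 := ramp_nonneg x
  have hq1 := ramp_le_one hx.le
  have hq2 : ramp x ^ 2 ≤ 1 := pow_le_one₀ hq0 hq1
  have hF : min 1 (κ / 16) / (2 * (θ + 1)) * F0 lam0 (1 / 2) θ x y ≤ min 1 (κ / 16) := by
    have hF' : F0 lam0 (1 / 2) θ x y ≤ 2 * (θ + 1) := by
      rw [F0_half h.ne', mul_comm 2]
      exact mul_le_mul (by linarith [pow_le_one₀ hq0 hq1 (n := 3)]) (by linarith)
        (by linarith) (by linarith)
    rw [div_mul_eq_mul_div, div_le_iff₀ (by positivity)]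
    exact mul_le_mul_of_nonneg_left hF' (by positivity)
  have hN := setIntegral_ramp_increment_nonpos (x := x) ν
  have hβq : 0 ≤ 6 * β * ramp x ^ 2 := by positivity
  have hD0 : 0 ≤ θ * (Real.exp (-(lam0 * (x - y)))
        * ((x - y) * Psi b c μ lam0 + 4 * c * y * lam0 ^ 2)
      + (y * (μ ⊓ Measure.map (fun z => z + (x - y)) μ).real (Set.Ioi 0)
        + (ν ⊓ Measure.map (fun z => z + (x - y)) ν).real (Set.Ioi 0)) / 4) := by positivity
  have hgx : 0 ≤ g x := hgnonneg x hx.le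
  have hKle : 6 * ramp x ^ 2 * (b * x + g x) + 24 * c * x * ramp x + 12 * x * ramp x * Iμ
      ≤ 6 * (|b| * x + g x) + 24 * c * x + 12 * x * Iμ := by
    have h1 : b * x ≤ |b| * x := mul_le_mul_of_nonneg_right (le_abs_self b) hx.le
    have h2 : ramp x ^ 2 * (b * x + g x) ≤ |b| * x + g x := by
      have h0 : 0 ≤ |b| * x + g x := by positivity
      exact (mul_le_mul_of_nonneg_left (by linarith) (sq_nonneg _)).trans
        (mul_le_of_le_one_left h0 hq2)
    have h3 : c * x * ramp x ≤ c * x := mul_le_of_le_one_right (by positivity) hq1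
    have h4 : x * Iμ * ramp x ≤ x * Iμ := mul_le_of_le_one_right (by positivity) hq1
    linarith
  rcases lt_or_ge x s with hxs | hxs
  · -- close to the origin
    rw [if_pos (by linarith), mul_one]
    have hN' := setIntegral_ramp_increment_le hx.le (by linarith) hν
    have hq : 1 / 2 ≤ ramp x := le_max_of_le_right (by linarith)
    have hβq' : β / 8 ≤ 6 * β * ramp x ^ 2 := by
      have hsq : (1 / 2) ^ 2 ≤ ramp x ^ 2 := pow_le_pow_left₀ (by norm_num) hq 2
      have := mul_le_mul_of_nonneg_left hsq hβ
      linarith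
    have hK := hsmall x hx.le hxs
    have hmin := min_le_right 1 (κ / 16)
    refine hmain.trans ?_
    have := mul_le_mul_of_nonneg_left (a := 2 - Real.exp (-(lam0 * (x - y)))) (by linarith :
      (∫ z in Set.Ioi (0 : ℝ), (ramp (x + z) ^ 3 - ramp x ^ 3) ∂ν)
        - 6 * β * ramp x ^ 2 + 6 * ramp x ^ 2 * (b * x + g x) + 24 * c * x * ramp x
        + 12 * x * ramp x * Iμ ≤ -(κ / 16)) (by linarith)
    have hB := mul_le_mul_of_nonneg_right
      (by linarith : 1 ≤ 2 - Real.exp (-(lam0 * (x - y)))) (by linarith : 0 ≤ κ / 16)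
    linarith
  · have hKC : (∫ z in Set.Ioi (0 : ℝ), (ramp (x + z) ^ 3 - ramp x ^ 3) ∂ν)
        - 6 * β * ramp x ^ 2 + 6 * ramp x ^ 2 * (b * x + g x) + 24 * c * x * ramp x
        + 12 * x * ramp x * Iμ ≤ if x < 1 / 2 then C else 0 := by
      split_ifs with hx2
      · have h1 : g x ≤ g (1 / 2) := hgmono hx.le (by norm_num [Set.mem_Ici]) hx2.le
        have h2 : |b| * x ≤ |b| := mul_le_of_le_one_right (abs_nonneg b) (by linarith)
        have h3 : c * x ≤ c := mul_le_of_le_one_right hc (by linarith)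
        have h4 : x * Iμ ≤ Iμ := mul_le_of_le_one_left hIμ (by linarith)
        linarith
      · have hq : ramp x = 0 := max_eq_left (by linarith)
        rw [hq] at hN ⊢
        linarith
    have hBK := mul_le_mul_of_nonneg_left hKC
      (by linarith : 0 ≤ 2 - Real.exp (-(lam0 * (x - y))))
    split_ifs with hxl
    · have h1 := mul_le_mul_of_nonneg_left (hdiss x y hy h hxs hxl) (by linarith : 0 ≤ θ)
      have hmin := min_le_left 1 (κ / 16)
      have h2 : (2 - Real.exp (-(lam0 * (x - y)))) * (if x < 1 / 2 then C else 0)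
          ≤ 2 * C := by
        split_ifs
        · exact mul_le_mul_of_nonneg_right (by linarith) hC0
        · linarith
      linarith
    · rw [if_neg (by linarith)] at hBK
      linarith
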